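/- Fix integers M ≥ 1, N ≥ 0, j ≥ 0 with M ∣ j·N, and let ω := exp(2πi/M). On the N-photon sector H_{M,N} := EuclideanSpace ℂ over {n : ZMod M → ℕ // ∑_m n(m) = N}, with X̂ e_n = e_{X·n} for (X·n)(m) := n(m−1), Ẑ e_n = ω^{μ(n)} e_n for μ(n) := ∑_{m∈ZMod M} n(m)·m, and Λ̂_j := X̂ ∘ Ẑ^j, define for a Fock vector n with ∑_m n(m) = N and an integer k the vector E_k(n) := ∑_{m=0}^{M−1} ω^{−k·m}·X̂^m e_n. Then Λ̂_j E_k(n) = ω^{k + j·μ(n)} · E_k(n). -/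

import Mathlib

noncomputable section

/-- The `N`-photon sector of an `M`-mode multi-rail system:
Fock vectors `n : ZMod M → ℕ` with total photon number `N`. -/
def Fock (M N : ℕ) [NeZero M] : Type :=
  {n : ZMod M → ℕ // ∑ m : ZMod M, n m = N}

/-- The cyclic mode shift on Fock vectors, `(X·n)(m) = n(m-1)`. -/
def Fock.shift {M N : ℕ} [NeZero M] (n : Fock M N) : Fock M N :=
  ⟨fun m => n.1 (m - 1),
    (Fintype.sum_equiv (Equiv.subRight (1 : ZMod M))
      (fun m => n.1 (m - 1)) n.1 (fun _ => rfl)).trans n.2⟩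

/-- The Z-clock label `μ(n) = ∑ m, n(m)·m ∈ ZMod M` of a Fock vector. -/
def Fock.mu {M N : ℕ} [NeZero M] (n : Fock M N) : ZMod M :=
  ∑ m : ZMod M, (n.1 m : ZMod M) * m

theorem Fock.mu_shift {M N : ℕ} [NeZero M] (n : Fock M N) :
    n.shift.mu = n.mu + N := by
  have hN : (∑ m : ZMod M, (n.1 m : ZMod M)) = N := by
    rw [← Nat.cast_sum, n.2]
  calc n.shift.mu = ∑ m : ZMod M, (n.1 m : ZMod M) * (m + 1) :=
        Fintype.sum_equiv (Equiv.subRight (1 : ZMod M)) _ _ fun m => by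
          simp [Fock.shift]
    _ = n.mu + N := by
        simp only [mul_add, mul_one, Finset.sum_add_distrib, hN, Fock.mu]

theorem Fock.mu_iterate_shift {M N : ℕ} [NeZero M] (n : Fock M N) (m : ℕ) :
    (Fock.shift^[m] n).mu = n.mu + m * N := by
  induction m with
  | zero => simp
  | succ m ih =>
    rw [Function.iterate_succ_apply', Fock.mu_shift, ih]
    push_cast
    ring

theorem Fock.iterate_shift_apply {M N : ℕ} [NeZero M] (n : Fock M N) (m : ℕ) (a : ZMod M) :
    (Fock.shift^[m] n).1 a = n.1 (a - m) := by
  induction m generalizing a with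
  | zero => simp
  | succ m ih =>
    rw [Function.iterate_succ_apply']
    change (Fock.shift^[m] n).1 (a - 1) = _
    rw [ih]
    exact congrArg n.1 (by push_cast; ring)

theorem Fock.iterate_shift_self {M N : ℕ} [NeZero M] (n : Fock M N) :
    Fock.shift^[M] n = n :=
  Subtype.ext <| funext fun a => by
    rw [Fock.iterate_shift_apply, ZMod.natCast_self, sub_zero]

theorem Fock.mul_val_mu_iterate_shift_modEq {M N j : ℕ} [NeZero M] (hjN : M ∣ j * N)
    (n : Fock M N) (m : ℕ) :
    j * (Fock.shift^[m] n).mu.val ≡ j * n.mu.val [MOD M] := by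
  rw [← ZMod.natCast_eq_natCast_iff]
  have h : (j : ZMod M) * N = 0 := by
    rw [← Nat.cast_mul, ZMod.natCast_eq_zero_iff]
    exact hjN
  push_cast
  rw [ZMod.natCast_zmod_val, ZMod.natCast_zmod_val, Fock.mu_iterate_shift]
  linear_combination (m : ZMod M) * h

theorem Module.End.pow_apply_of_apply_eq_smul {R V : Type*} [CommRing R] [AddCommGroup V]
    [Module R V] {f : Module.End R V} {c : R} {v : V} (h : f v = c • v) (j : ℕ) :
    (f ^ j) v = c ^ j • v := by
  induction j with
  | zero => simp
  | succ j ih => rw [pow_succ', Module.End.mul_apply, ih, map_smul, h, smul_smul, pow_succ]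

theorem Module.End.apply_sum_zpow_smul_pow_apply {K V : Type*} [Field K] [AddCommGroup V]
    [Module K V] {f : Module.End K V} {v : V} {M : ℕ} {ω : K} (hω0 : ω ≠ 0) (hω : ω ^ M = 1)
    (hf : (f ^ M) v = v) (k : ℤ) :
    f (∑ m ∈ Finset.range M, ω ^ (-(k * (m : ℤ))) • (f ^ m) v) =
      ω ^ k • ∑ m ∈ Finset.range M, ω ^ (-(k * (m : ℤ))) • (f ^ m) v := by
  have hper : ω ^ (-(k * (M : ℤ))) = 1 := by
    rw [neg_mul_eq_neg_mul, mul_comm, zpow_mul, zpow_natCast, hω, one_zpow]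
  have hcycle : ∑ m ∈ Finset.range M, ω ^ (-(k * ((m + 1 : ℕ) : ℤ))) • (f ^ (m + 1)) v =
      ∑ m ∈ Finset.range M, ω ^ (-(k * (m : ℤ))) • (f ^ m) v := by
    have h := (Finset.sum_range_succ' (fun m : ℕ => ω ^ (-(k * (m : ℤ))) • (f ^ m) v) M).symm.trans
      (Finset.sum_range_succ _ M)
    simpa [hper, hf] using h
  conv_rhs => rw [← hcycle]
  rw [map_sum, Finset.smul_sum]
  refine Finset.sum_congr rfl fun m _ => ?_
  rw [map_smul, smul_smul, ← zpow_add₀ hω0, pow_succ', Module.End.mul_apply]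
  congr 2
  push_cast
  ring

theorem stmt13 (M N j : ℕ) (hM : 1 ≤ M) [NeZero M] (hjN : M ∣ j * N)
    [Fintype (Fock M N)] [DecidableEq (Fock M N)]
    (ω : ℂ) (hω : ω = Complex.exp (2 * Real.pi * Complex.I / M))
    (X Z : Module.End ℂ (EuclideanSpace ℂ (Fock M N)))
    (hX : ∀ n : Fock M N,
      X (EuclideanSpace.single n 1) = EuclideanSpace.single n.shift 1)
    (hZ : ∀ n : Fock M N,
      Z (EuclideanSpace.single n 1) = ω ^ (Fock.mu n).val • EuclideanSpace.single n 1)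
    (n : Fock M N) (k : ℤ)
    (E : EuclideanSpace ℂ (Fock M N))
    (hE : E = ∑ m ∈ Finset.range M,
      ω ^ (-(k * (m : ℤ))) • (X ^ m) (EuclideanSpace.single n 1)) :
    (X ∘ₗ Z ^ j) E = ω ^ (k + ((j * (Fock.mu n).val : ℕ) : ℤ)) • E := by
  have hω0 : ω ≠ 0 := hω ▸ Complex.exp_ne_zero _
  have hωM : ω ^ M = 1 := hω ▸ (Complex.isPrimitiveRoot_exp M (NeZero.ne M)).pow_eq_one
  have hXpow (m : ℕ) : (X ^ m) (EuclideanSpace.single n 1) =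
      EuclideanSpace.single (Fock.shift^[m] n) 1 := by
    induction m with
    | zero => simp
    | succ m ih =>
      rw [pow_succ', Module.End.mul_apply, ih, hX, Function.iterate_succ_apply']
  have hZX (m : ℕ) : (Z ^ j) ((X ^ m) (EuclideanSpace.single n 1)) =
      ω ^ (j * n.mu.val) • (X ^ m) (EuclideanSpace.single n 1) := by
    rw [hXpow, Module.End.pow_apply_of_apply_eq_smul (hZ _), ← pow_mul, mul_comm,
      pow_eq_pow_mod _ hωM, Fock.mul_val_mu_iterate_shift_modEq hjN n m, ← pow_eq_pow_mod _ hωM]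
  have hZE : (Z ^ j) E = ω ^ (j * n.mu.val) • E := by
    rw [hE, map_sum, Finset.smul_sum]
    exact Finset.sum_congr rfl fun m _ => by rw [map_smul, hZX, smul_comm]
  have hXE : X E = ω ^ k • E := by
    rw [hE]
    exact Module.End.apply_sum_zpow_smul_pow_apply hω0 hωM
      (by rw [hXpow, Fock.iterate_shift_self]) k
  rw [LinearMap.comp_apply, hZE, map_smul, hXE, smul_smul, zpow_add₀ hω0, zpow_natCast, mul_comm]
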